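/- arXiv:2509.01347 — 4 statements merged into one kernel-verified Lean document; each statement's English description precedes it below -/
import Mathlib

section
/- Let $A \in \mathbb{R}^{a \times n}$, $B \in \mathbb{R}^{b \times n}$, $C \in \mathbb{R}^{c \times n}$, let $O = \begin{bmatrix} A \\ B \\ C \end{bmatrix} \in \mathbb{R}^{(a+b+c) \times n}$ (vertical stack), and let $K \in \mathbb{R}^{q \times (a+b+c)}$ satisfy $\mathcal{N}(K) = \mathcal{R}(O)$. Let $T_1 = \begin{bmatrix} 0 \\ I_b \\ 0 \end{bmatrix} \in \mathbb{R}^{(a+b+c) \times b}$ and $T_2 = \begin{bmatrix} 0 \\ 0 \\ I_c \end{bmatrix} \in \mathbb{R}^{(a+b+c) \times c}$. If $A$ has full column rank $n$, then $\mathcal{R}(K T_1) \cap \mathcal{R}(K T_2) = \{0\}$. -/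
open Matrix

/-- A real matrix of full column rank has trivial kernel. -/
theorem Matrix.ker_mulVecLin_eq_bot_of_rank_eq {m n : ℕ} (A : Matrix (Fin m) (Fin n) ℝ)
    (hA : A.rank = n) : LinearMap.ker A.mulVecLin = ⊥ := by
  have h := LinearMap.finrank_range_add_finrank_ker A.mulVecLin
  rw [← Matrix.rank, hA, Module.finrank_fin_fun] at h
  exact Submodule.finrank_eq_zero.mp (by omega)

/-- Two distinct sensor-fault dictionaries intersect trivially when the
observability matrix of the remaining outputs has full column rank. -/
theorem stmt_13 (a b c n q : ℕ)
    (A : Matrix (Fin a) (Fin n) ℝ) (B : Matrix (Fin b) (Fin n) ℝ)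
    (C : Matrix (Fin c) (Fin n) ℝ)
    (O : Matrix (Fin a ⊕ (Fin b ⊕ Fin c)) (Fin n) ℝ)
    (hO : O = Matrix.fromRows A (Matrix.fromRows B C))
    (K : Matrix (Fin q) (Fin a ⊕ (Fin b ⊕ Fin c)) ℝ)
    (hK : LinearMap.ker K.mulVecLin = LinearMap.range O.mulVecLin)
    (T₁ : Matrix (Fin a ⊕ (Fin b ⊕ Fin c)) (Fin b) ℝ)
    (hT₁ : T₁ = Matrix.fromRows 0 (Matrix.fromRows (1 : Matrix (Fin b) (Fin b) ℝ) 0))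
    (T₂ : Matrix (Fin a ⊕ (Fin b ⊕ Fin c)) (Fin c) ℝ)
    (hT₂ : T₂ = Matrix.fromRows 0 (Matrix.fromRows 0 (1 : Matrix (Fin c) (Fin c) ℝ)))
    (hA : A.rank = n) :
    LinearMap.range (K * T₁).mulVecLin ⊓ LinearMap.range (K * T₂).mulVecLin = ⊥ := by
  subst hO hT₁ hT₂
  rw [eq_bot_iff]
  rintro y ⟨⟨u, rfl⟩, ⟨v, hv⟩⟩
  simp only [mulVecLin_apply, ← mulVec_mulVec] at hv
  have hmem : fromRows 0 (fromRows (1 : Matrix (Fin b) (Fin b) ℝ) 0) *ᵥ u -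
      fromRows 0 (fromRows 0 (1 : Matrix (Fin c) (Fin c) ℝ)) *ᵥ v ∈
        LinearMap.ker K.mulVecLin := by
    rw [LinearMap.mem_ker, mulVecLin_apply, mulVec_sub, hv, sub_self]
  rw [hK] at hmem
  obtain ⟨x, hx⟩ := hmem
  have hAx : A *ᵥ x = 0 := by
    ext i
    simpa [fromRows_mulVec] using congrFun hx (Sum.inl i)
  have hx0 : x = 0 := by
    have : x ∈ LinearMap.ker A.mulVecLin := hAx
    rwa [A.ker_mulVecLin_eq_bot_of_rank_eq hA, Submodule.mem_bot] at this
  have hu : u = 0 := by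
    ext i
    simpa [fromRows_mulVec, hx0, eq_comm] using congrFun hx (Sum.inr (Sum.inl i))
  simp [hu]
end

section
/- Let $B \in \mathbb{R}^{b \times n}$ and $C \in \mathbb{R}^{c \times n}$ both have full column rank $n$, let $O = \begin{bmatrix} B \\ C \end{bmatrix} \in \mathbb{R}^{(b+c) \times n}$, and let $K \in \mathbb{R}^{q \times (b+c)}$ satisfy $\mathcal{N}(K) = \mathcal{R}(O)$ and $\mathcal{R}(K^{\top}) = \mathcal{N}(O^{\top})$. Let $T_1 = \begin{bmatrix} I_b \\ 0 \end{bmatrix}$ and $T_2 = \begin{bmatrix} 0 \\ I_c \end{bmatrix}$. Then $\dim\left(\mathcal{R}(K T_1) \cap \mathcal{R}(K T_2)\right) = n$. -/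
open Matrix

/-- A real matrix whose rank equals its number of columns acts injectively. -/
theorem Matrix.mulVec_injective_of_rank_eq {m n : ℕ} {A : Matrix (Fin m) (Fin n) ℝ}
    (hA : A.rank = n) : Function.Injective A.mulVec := by
  have h := A.mulVecLin.finrank_range_add_finrank_ker
  rw [Module.finrank_fin_fun] at h
  have hr : Module.finrank ℝ (LinearMap.range A.mulVecLin) = n := hA
  have h0 : Module.finrank ℝ (LinearMap.ker A.mulVecLin) = 0 := by omega
  exact LinearMap.ker_eq_bot.mp (Submodule.finrank_eq_zero.mp h0)

/-- For a system with exactly two outputs, the dictionaries of the two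
sensor faults intersect in a subspace of dimension `n`. -/
theorem stmt_14 (b c n q : ℕ)
    (B : Matrix (Fin b) (Fin n) ℝ) (C : Matrix (Fin c) (Fin n) ℝ)
    (hB : B.rank = n) (hC : C.rank = n)
    (O : Matrix (Fin b ⊕ Fin c) (Fin n) ℝ)
    (hO : O = Matrix.fromRows B C)
    (K : Matrix (Fin q) (Fin b ⊕ Fin c) ℝ)
    (hK : LinearMap.ker K.mulVecLin = LinearMap.range O.mulVecLin)
    (hK' : LinearMap.range (Kᵀ).mulVecLin = LinearMap.ker (Oᵀ).mulVecLin)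
    (T₁ : Matrix (Fin b ⊕ Fin c) (Fin b) ℝ)
    (hT₁ : T₁ = Matrix.fromRows (1 : Matrix (Fin b) (Fin b) ℝ) 0)
    (T₂ : Matrix (Fin b ⊕ Fin c) (Fin c) ℝ)
    (hT₂ : T₂ = Matrix.fromRows 0 (1 : Matrix (Fin c) (Fin c) ℝ)) :
    Module.finrank ℝ
      ↥(LinearMap.range (K * T₁).mulVecLin ⊓ LinearMap.range (K * T₂).mulVecLin)
      = n := by
  subst hO
  have hBi := Matrix.mulVec_injective_of_rank_eq hB
  have hCi := Matrix.mulVec_injective_of_rank_eq hC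
  have key : ∀ u v, K *ᵥ Sum.elim u v = 0 ↔ ∃ z, B *ᵥ z = u ∧ C *ᵥ z = v := by
    intro u v
    have h := SetLike.ext_iff.mp hK (Sum.elim u v)
    simpa [Matrix.fromRows_mulVec, Sum.elim_eq_iff] using h
  have h1 : ∀ u : Fin b → ℝ,
      (K * T₁) *ᵥ u = K *ᵥ Sum.elim u 0 := by
    intro u
    rw [← Matrix.mulVec_mulVec, hT₁, Matrix.fromRows_mulVec, Matrix.one_mulVec, Matrix.zero_mulVec]
  have h2 : ∀ v : Fin c → ℝ,
      (K * T₂) *ᵥ v = K *ᵥ Sum.elim 0 v := by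
    intro v
    rw [← Matrix.mulVec_mulVec, hT₂, Matrix.fromRows_mulVec, Matrix.one_mulVec, Matrix.zero_mulVec]
  have hsub : ∀ (u : Fin b → ℝ) (v : Fin c → ℝ),
      K *ᵥ Sum.elim u 0 - K *ᵥ Sum.elim 0 v = K *ᵥ Sum.elim u (-v) := by
    intro u v
    rw [← Matrix.mulVec_sub]
    congr 1
    ext (i | i) <;> simp
  let f := (K * T₁).mulVecLin ∘ₗ B.mulVecLin
  have hf : ∀ x, f x = K *ᵥ Sum.elim (B *ᵥ x) 0 := fun x => h1 _
  have hrange : LinearMap.range (K * T₁).mulVecLin ⊓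
      LinearMap.range (K * T₂).mulVecLin =
      LinearMap.range f := by
    ext y
    constructor
    · rintro ⟨⟨u, hu⟩, ⟨v, hv⟩⟩
      rw [Matrix.mulVecLin_apply, h1] at hu
      rw [Matrix.mulVecLin_apply, h2] at hv
      obtain ⟨z, hz, -⟩ := (key u (-v)).mp (by rw [← hsub, hu, hv, sub_self])
      exact ⟨z, by rw [hf, hz, hu]⟩
    · rintro ⟨x, rfl⟩
      refine ⟨⟨B *ᵥ x, rfl⟩, -(C *ᵥ x), ?_⟩
      rw [Matrix.mulVecLin_apply, h2, hf, eq_comm, ← sub_eq_zero, hsub, neg_neg, key]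
      exact ⟨x, rfl, rfl⟩
  have hinj : Function.Injective f := by
    rw [injective_iff_map_eq_zero]
    intro x hx
    rw [hf, key] at hx
    obtain ⟨z, hz, hz0⟩ := hx
    rw [← hBi hz]
    exact hCi (by rw [hz0, Matrix.mulVec_zero])
  rw [hrange, LinearMap.finrank_range_of_inj hinj, Module.finrank_fin_fun]
end

section
/- Let $A \in \mathbb{C}^{n \times n}$, $B \in \mathbb{C}^{n \times m}$, $C \in \mathbb{C}^{p \times n}$, $D \in \mathbb{C}^{p \times m}$, and let $G = C'(\mathrm{z} I_n - A')^{-1} B' + D'$ be the $p \times m$ transfer function matrix over the field $\mathbb{C}(\mathrm{z})$ of rational functions, where primes denote the entrywise images of the matrices in $\mathbb{C}(\mathrm{z})$ and $\mathrm{z}$ is the indeterminate (note $\mathrm{z} I_n - A'$ is invertible over $\mathbb{C}(\mathrm{z})$ since its determinant is the characteristic polynomial of $A$, which is nonzero). Then the following are equivalent: (i) there exist an $m \times p$ matrix $H$ over $\mathbb{C}(\mathrm{z})$ and $\tau \in \mathbb{N}$ with $H G = \mathrm{z}^{-\tau} I_m$; (ii) the set of $z \in \mathbb{C}$ for which $\operatorname{rank}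 \begin{bmatrix} A - z I_n & B \\ C & D \end{bmatrix} < n + m$ is finite. -/
open Matrix

/-- Over a field, a matrix with trivial kernel has a left inverse. -/
theorem Matrix.exists_mul_eq_one_of_mulVec_injective {K ι κ : Type*} [Field K] [Fintype ι]
    [Fintype κ] [DecidableEq κ] {M : Matrix ι κ K} (hM : Function.Injective M.mulVec) :
    ∃ L : Matrix κ ι K, L * M = 1 := by
  classical
  obtain ⟨g, hg⟩ := (toLin' M).exists_leftInverse_of_injective (LinearMap.ker_eq_bot.2 hM)
  refine ⟨LinearMap.toMatrix' g, ?_⟩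
  rw [← LinearMap.toMatrix'_toLin' M, ← LinearMap.toMatrix'_comp, hg, LinearMap.toMatrix'_id]

theorem Matrix.mulVec_injective_of_mul_eq_one {R ι κ : Type*} [CommRing R] [Fintype ι]
    [Fintype κ] [DecidableEq κ] {L : Matrix κ ι R} {M : Matrix ι κ R} (h : L * M = 1) :
    Function.Injective M.mulVec := by
  intro u v huv
  simpa [h] using congrArg (L *ᵥ ·) huv

theorem Matrix.mulVec_injective_iff_forall {R ι κ : Type*} [CommRing R] [Fintype κ]
    {M : Matrix ι κ R} : Function.Injective M.mulVec ↔ ∀ v, M *ᵥ v = 0 → v = 0 :=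
  injective_iff_map_eq_zero M.mulVecLin

/-- The rank of a matrix over a field is the number of its columns iff its kernel is trivial. -/
theorem Matrix.rank_lt_card_iff {K ι κ : Type*} [Field K] [Fintype ι] [Fintype κ]
    {M : Matrix ι κ K} : M.rank < Fintype.card κ ↔ ¬ Function.Injective M.mulVec := by
  have h := M.mulVecLin.finrank_range_add_finrank_ker
  rw [Module.finrank_fintype_fun_eq_card] at h
  have h0 : Function.Injective M.mulVec ↔ Module.finrank K (LinearMap.ker M.mulVecLin) = 0 := by
    rw [Submodule.finrank_eq_zero, LinearMap.ker_eq_bot]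
    rfl
  rw [h0, Matrix.rank]
  omega

/-- A polynomial matrix is injective over the fraction field iff all but finitely many of its
evaluations have full column rank. -/
theorem Matrix.mulVec_injective_map_algebraMap_iff {k K ι κ : Type*} [Field k] [Infinite k]
    [Field K] [Algebra (Polynomial k) K] [IsFractionRing (Polynomial k) K] [Fintype ι] [Fintype κ]
    (M : Matrix ι κ (Polynomial k)) :
    Function.Injective (M.map (algebraMap (Polynomial k) K)).mulVec ↔
      {z : k | (M.map (Polynomial.evalRingHom z)).rank < Fintype.card κ}.Finite := by
  classical
  have hinj := IsFractionRing.injective (Polynomial k) K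
  constructor
  · intro hM
    obtain ⟨L, hL⟩ := exists_mul_eq_one_of_mulVec_injective hM
    obtain ⟨⟨d, hd⟩, hdL⟩ := IsLocalization.exist_integer_multiples_of_finite
      (nonZeroDivisors (Polynomial k)) fun ij : κ × ι => L ij.1 ij.2
    choose N hN using hdL
    have hd0 : d ≠ 0 := nonZeroDivisors.ne_zero hd
    have hNL : (Matrix.of fun i j => N (i, j)).map (algebraMap (Polynomial k) K) =
        algebraMap (Polynomial k) K d • L := by
      ext i j
      simpa [Algebra.smul_def] using hN (i, j)
    have hNM : (Matrix.of fun i j => N (i, j)) * M = d • (1 : Matrix κ κ (Polynomial k)) := by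
      apply Matrix.map_injective hinj
      beta_reduce
      rw [Matrix.map_mul, hNL, Matrix.smul_mul, hL]
      ext i j
      by_cases hij : i = j <;> simp [hij]
    refine (Polynomial.finite_setOfPred_isRoot hd0).subset fun z hz => ?_
    by_contra hdz
    refine rank_lt_card_iff.1 hz (mulVec_injective_iff_forall.2 fun v hv => ?_)
    have h := congrArg (fun P : Matrix κ κ (Polynomial k) =>
      P.map (Polynomial.evalRingHom z) *ᵥ v) hNM
    simp only [Matrix.map_mul, ← Matrix.mulVec_mulVec, hv, Matrix.mulVec_zero] at h
    have hdm : (d • (1 : Matrix κ κ (Polynomial k))).map (Polynomial.evalRingHom z) =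
        d.eval z • (1 : Matrix κ κ k) := by
      ext i j
      by_cases hij : i = j <;> simp [hij]
    rw [hdm, Matrix.smul_mulVec, Matrix.one_mulVec] at h
    exact (smul_eq_zero.1 h.symm).resolve_left hdz
  · intro hfin
    refine mulVec_injective_iff_forall.2 fun v hv => ?_
    obtain ⟨⟨d, hd⟩, hdv⟩ := IsLocalization.exist_integer_multiples_of_finite
      (nonZeroDivisors (Polynomial k)) v
    choose w hw using hdv
    have hd0 : algebraMap (Polynomial k) K d ≠ 0 :=
      (map_ne_zero_iff _ hinj).2 (nonZeroDivisors.ne_zero hd)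
    have hwv : algebraMap (Polynomial k) K ∘ w = algebraMap (Polynomial k) K d • v := by
      ext i
      simpa [Algebra.smul_def] using hw i
    have hMw : M *ᵥ w = 0 := by
      ext1 i
      apply hinj
      rw [RingHom.map_mulVec, hwv, Matrix.mulVec_smul, hv]
      simp
    by_contra hv0
    obtain ⟨i, hi⟩ := Function.ne_iff.1 hv0
    have hwi : w i ≠ 0 := by
      intro h
      have := congrFun hwv i
      simp only [Function.comp_apply, h, map_zero, Pi.smul_apply, smul_eq_mul] at this
      exact (mul_ne_zero hd0 hi) this.symm
    refine Set.infinite_univ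
      ((hfin.union (Polynomial.finite_setOfPred_isRoot hwi)).subset fun z _ => ?_)
    by_contra hz
    simp only [Set.mem_union, not_or] at hz
    refine hz.1 (rank_lt_card_iff.2 fun h => hz.2 ?_)
    have hz0 := mulVec_injective_iff_forall.1 h (Polynomial.evalRingHom z ∘ w) <| by
      ext i
      rw [← RingHom.map_mulVec, hMw]
      simp
    exact congrFun hz0 i

/-- A block matrix with invertible upper left corner is injective iff its Schur complement is. -/
theorem Matrix.mulVec_injective_fromBlocks_iff {R ι κ ν : Type*} [CommRing R] [Fintype κ]
    [Fintype ν] [DecidableEq ν] {A : Matrix ν ν R} (hA : IsUnit A.det) (B : Matrix ν κ R)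
    (C : Matrix ι ν R) (D : Matrix ι κ R) :
    Function.Injective (fromBlocks A B C D).mulVec ↔
      Function.Injective (D - C * A⁻¹ * B).mulVec := by
  simp only [mulVec_injective_iff_forall]
  constructor
  · intro h u hu
    have hz := h (Sum.elim (-(A⁻¹ *ᵥ (B *ᵥ u))) u) <| by
      rw [fromBlocks_mulVec, Sum.elim_comp_inl, Sum.elim_comp_inr, Matrix.mulVec_neg,
        Matrix.mulVec_mulVec, Matrix.mul_nonsing_inv _ hA, Matrix.one_mulVec, neg_add_cancel]
      rw [Matrix.sub_mulVec, ← Matrix.mulVec_mulVec, ← Matrix.mulVec_mulVec] at hu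
      rw [Matrix.mulVec_neg, neg_add_eq_sub, hu, Sum.elim_zero_zero]
    ext i
    exact congrFun hz (Sum.inr i)
  · intro h v hv
    obtain ⟨x, u, rfl⟩ : ∃ x u, v = Sum.elim x u := ⟨_, _, (Sum.elim_comp_inl_inr v).symm⟩
    rw [fromBlocks_mulVec, Sum.elim_comp_inl, Sum.elim_comp_inr, ← Sum.elim_zero_zero,
      Sum.elim_eq_iff] at hv
    obtain ⟨h1, h2⟩ := hv
    have hx : x = -(A⁻¹ *ᵥ (B *ᵥ u)) := by
      rw [← Matrix.mulVec_neg, ← eq_neg_of_add_eq_zero_left h1, Matrix.mulVec_mulVec,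
        Matrix.nonsing_inv_mul _ hA, Matrix.one_mulVec]
    have hu : u = 0 := h u <| by
      rw [Matrix.sub_mulVec, ← Matrix.mulVec_mulVec, ← Matrix.mulVec_mulVec, ← neg_add_eq_sub,
        ← Matrix.mulVec_neg, ← hx, h2]
    subst hu
    simp [hx]

set_option synthInstance.maxHeartbeats 1000000 in
set_option maxHeartbeats 1000000 in
/-- Left invertibility of the transfer matrix
`G = C (zI - A)⁻¹ B + D` over `ℂ(z)` is equivalent to the Rosenbrock
system matrix having rank `n + m` for all but finitely many `z ∈ ℂ`. -/
theorem stmt_17 (n m p : ℕ)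
    (A : Matrix (Fin n) (Fin n) ℂ) (B : Matrix (Fin n) (Fin m) ℂ)
    (C : Matrix (Fin p) (Fin n) ℂ) (D : Matrix (Fin p) (Fin m) ℂ)
    (G : Matrix (Fin p) (Fin m) (RatFunc ℂ))
    (hG : G = C.map (RatFunc.C : ℂ →+* RatFunc ℂ) *
        ((RatFunc.X : RatFunc ℂ) • (1 : Matrix (Fin n) (Fin n) (RatFunc ℂ))
          - A.map (RatFunc.C : ℂ →+* RatFunc ℂ))⁻¹ *
        B.map (RatFunc.C : ℂ →+* RatFunc ℂ)
      + D.map (RatFunc.C : ℂ →+* RatFunc ℂ)) :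
    (∃ (H : Matrix (Fin m) (Fin p) (RatFunc ℂ)) (τ : ℕ),
        H * G = ((RatFunc.X : RatFunc ℂ)⁻¹ ^ τ) •
          (1 : Matrix (Fin m) (Fin m) (RatFunc ℂ)))
      ↔ {z : ℂ |
          (Matrix.fromBlocks (A - z • (1 : Matrix (Fin n) (Fin n) ℂ)) B C D).rank
            < n + m}.Finite := by
  have hleft : (∃ (H : Matrix (Fin m) (Fin p) (RatFunc ℂ)) (τ : ℕ),
      H * G = ((RatFunc.X : RatFunc ℂ)⁻¹ ^ τ) • (1 : Matrix (Fin m) (Fin m) (RatFunc ℂ))) ↔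
      Function.Injective G.mulVec := by
    constructor
    · rintro ⟨H, τ, hH⟩
      refine mulVec_injective_of_mul_eq_one (L := (RatFunc.X : RatFunc ℂ) ^ τ • H) ?_
      rw [Matrix.smul_mul, hH, smul_smul, ← mul_pow, mul_inv_cancel₀ RatFunc.X_ne_zero, one_pow,
        one_smul]
    · intro hG
      obtain ⟨L, hL⟩ := exists_mul_eq_one_of_mulVec_injective hG
      exact ⟨L, 0, by rw [hL, pow_zero, one_smul]⟩
  set T : Matrix (Fin n) (Fin n) (RatFunc ℂ) :=
    (RatFunc.X : RatFunc ℂ) • 1 - A.map (RatFunc.C : ℂ →+* RatFunc ℂ) with hT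
  have hTchar : T = A.charmatrix.map (algebraMap (Polynomial ℂ) (RatFunc ℂ)) := by
    ext i j
    by_cases hij : i = j <;> simp [hT, hij]
  have hTdet : IsUnit T.det := by
    rw [hTchar, ← RingHom.mapMatrix_apply, ← RingHom.map_det, isUnit_iff_ne_zero]
    exact (map_ne_zero_iff _ (IsFractionRing.injective _ _)).2 A.charpoly_monic.ne_zero
  have hTneg : IsUnit (-T).det := by
    rw [Matrix.det_neg]
    exact (isUnit_one.neg.pow _).mul hTdet
  have hTinv : (-T)⁻¹ = -T⁻¹ :=
    Matrix.inv_eq_left_inv (by rw [neg_mul_neg, Matrix.nonsing_inv_mul _ hTdet])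
  let R : Matrix (Fin n ⊕ Fin p) (Fin n ⊕ Fin m) (Polynomial ℂ) :=
    fromBlocks (-A.charmatrix) (B.map Polynomial.C) (C.map Polynomial.C) (D.map Polynomial.C)
  have hRK : R.map (algebraMap (Polynomial ℂ) (RatFunc ℂ)) =
      fromBlocks (-T) (B.map (RatFunc.C : ℂ →+* RatFunc ℂ))
        (C.map (RatFunc.C : ℂ →+* RatFunc ℂ)) (D.map (RatFunc.C : ℂ →+* RatFunc ℂ)) := by
    rw [hTchar, fromBlocks_map]
    congr 1
    all_goals ext i j; simp
  have hReval (z : ℂ) : R.map (Polynomial.evalRingHom z) =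
      fromBlocks (A - z • (1 : Matrix (Fin n) (Fin n) ℂ)) B C D := by
    rw [fromBlocks_map]
    congr 1
    all_goals ext i j
    · by_cases hij : i = j <;> simp [hij]
    all_goals simp
  have hR := mulVec_injective_map_algebraMap_iff (K := RatFunc ℂ) R
  simp only [hReval, Fintype.card_sum, Fintype.card_fin] at hR
  rw [hleft, ← hR, hRK, mulVec_injective_fromBlocks_iff hTneg, hTinv, hG, Matrix.mul_neg,
    Matrix.neg_mul, sub_neg_eq_add, add_comm]
end

section
/- Let $U \in \mathbb{R}^{p \times N}$, $X \in \mathbb{R}^{n \times N}$, $O \in \mathbb{R}^{m \times n}$ with full column rank $n$, $T \in \mathbb{R}^{m \times p}$, and $Y = O X + T U$. Assume $\operatorname{rank} \begin{bmatrix} X \\ U \end{bmatrix} = n + p$ (full row rank). Suppose there are matrices $Q_1 \in \mathbb{R}^{N \times p}$, $Q_2 \in \mathbb{R}^{N \times q}$ with $Q_1^{\top} Q_1 = I_p$, $Q_2^{\top} Q_2 = I_q$, $Q_1^{\top} Q_2 = 0$, an invertible $L_{11} \in \mathbb{R}^{p \times p}$, and $L_{21} \in \mathbb{R}^{m \times p}$,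 $L_{22} \in \mathbb{R}^{m \times q}$ such that $U = L_{11} Q_1^{\top}$ and $Y = L_{21} Q_1^{\top} + L_{22} Q_2^{\top}$. Then $\mathcal{R}(L_{22}) = \mathcal{R}(O)$. -/
open Matrix

/-- A matrix of full row rank induces a surjective linear map. -/
theorem mulVec_surjective_of_rank_eq_card {m n K : Type*} [Fintype m] [Fintype n] [Field K]
    (A : Matrix m n K) (hA : A.rank = Fintype.card m) : Function.Surjective A.mulVec := by
  have h : LinearMap.range A.mulVecLin = ⊤ :=
    Submodule.eq_top_of_finrank_eq (by rw [Module.finrank_fintype_fun_eq_card, ← hA, Matrix.rank])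
  exact LinearMap.range_eq_top.mp h

/-- LQ-decomposition recovery of the observability range: under the
persistency-of-excitation rank condition, `ℛ(L₂₂) = ℛ(O)`. -/
theorem stmt_19 (p n m N q : ℕ)
    (U : Matrix (Fin p) (Fin N) ℝ) (X : Matrix (Fin n) (Fin N) ℝ)
    (O : Matrix (Fin m) (Fin n) ℝ) (T : Matrix (Fin m) (Fin p) ℝ)
    (Y : Matrix (Fin m) (Fin N) ℝ)
    (hO : O.rank = n)
    (hY : Y = O * X + T * U)
    (hPE : (Matrix.fromRows X U).rank = n + p)
    (Q₁ : Matrix (Fin N) (Fin p) ℝ) (Q₂ : Matrix (Fin N) (Fin q) ℝ)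
    (hQ₁ : Q₁ᵀ * Q₁ = 1) (hQ₂ : Q₂ᵀ * Q₂ = 1) (hQ₁₂ : Q₁ᵀ * Q₂ = 0)
    (L₁₁ : Matrix (Fin p) (Fin p) ℝ) (hL₁₁ : IsUnit L₁₁)
    (L₂₁ : Matrix (Fin m) (Fin p) ℝ) (L₂₂ : Matrix (Fin m) (Fin q) ℝ)
    (hU : U = L₁₁ * Q₁ᵀ) (hYdec : Y = L₂₁ * Q₁ᵀ + L₂₂ * Q₂ᵀ) :
    LinearMap.range L₂₂.mulVecLin = LinearMap.range O.mulVecLin := by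
  have hQ₁w : ∀ w, U *ᵥ w = 0 → Q₁ᵀ *ᵥ w = 0 := fun w hw => by
    refine Matrix.mulVec_injective_of_isUnit hL₁₁ ?_
    rw [Matrix.mulVec_mulVec, ← hU, hw, Matrix.mulVec_zero]
  apply le_antisymm
  · have hL : L₂₂ = O * (X * Q₂) := by
      calc L₂₂ = Y * Q₂ := by
            rw [hYdec, Matrix.add_mul, Matrix.mul_assoc, Matrix.mul_assoc, hQ₁₂, hQ₂,
              Matrix.mul_zero, Matrix.mul_one, zero_add]
        _ = O * (X * Q₂) := by
            rw [hY, hU, Matrix.add_mul, Matrix.mul_assoc, Matrix.mul_assoc, Matrix.mul_assoc,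
              hQ₁₂, Matrix.mul_zero, Matrix.mul_zero, add_zero]
    rw [hL, Matrix.mulVecLin_mul]
    exact LinearMap.range_comp_le_range _ _
  · rintro _ ⟨v, rfl⟩
    obtain ⟨w, hw⟩ := mulVec_surjective_of_rank_eq_card (Matrix.fromRows X U)
      (by simpa using hPE) (Sum.elim v 0)
    rw [Matrix.fromRows_mulVec, Sum.elim_eq_iff] at hw
    obtain ⟨hXw, hUw⟩ := hw
    refine ⟨Q₂ᵀ *ᵥ w, ?_⟩
    have h : (O * X + T * U) *ᵥ w = (L₂₁ * Q₁ᵀ + L₂₂ * Q₂ᵀ) *ᵥ w := by rw [← hY, ← hYdec]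
    simp only [Matrix.add_mulVec, ← Matrix.mulVec_mulVec, hXw, hUw, hQ₁w w hUw,
      Matrix.mulVec_zero, add_zero, zero_add] at h
    exact h.symm
end
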